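/- Any finite graph H without isolated vertices admits an optimal fractional edge cover x* whose support is a vertex-disjoint union of odd cycles and stars, where x*_e = 1/2 on every edge of each odd cycle in the support and x*_e = 1 on every support edge not belonging to an odd cycle. -/

import Mathlib

open Finset

def IsFracEdgeCover {V : Type*} [Fintype V] [DecidableEq V] (G : SimpleGraph V)
    [DecidableRel G.Adj] (x : Sym2 V → ℝ) : Prop :=
  (∀ e, 0 ≤ x e ∧ x e ≤ 1) ∧ (∀ e, e ∉ G.edgeFinset → x e = 0) ∧
    ∀ a : V, 1 ≤ ∑ e ∈ G.incidenceFinset a, x e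

/-- `S` is the edge set of an odd cycle of `G`. -/
def IsOddCycleEdgeSet {V : Type*} [DecidableEq V] (G : SimpleGraph V)
    (S : Finset (Sym2 V)) : Prop :=
  ∃ (v : V) (w : G.Walk v v), w.IsCycle ∧ Odd w.length ∧ S = w.edges.toFinset

/-- `S` is the edge set of a star of `G`: a nonempty set of edges all sharing a common
center vertex. -/
def IsStarEdgeSet {V : Type*} [Fintype V] [DecidableEq V] (G : SimpleGraph V)
    [DecidableRel G.Adj] (S : Finset (Sym2 V)) : Prop :=
  S.Nonempty ∧ S ⊆ G.edgeFinset ∧ ∃ c : V, ∀ e ∈ S, c ∈ e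


def FecM {V : Type*} (G : SimpleGraph V) (M : Finset (V × V)) : Prop :=
  (∀ a b, (a, b) ∈ M → G.Adj a b) ∧ (∀ a b c, (a, b) ∈ M → (a, c) ∈ M → b = c) ∧
    (∀ a b c, (a, c) ∈ M → (b, c) ∈ M → a = b)

def fecSy {V : Type*} [DecidableEq V] (M : Finset (V × V)) : Finset (V × V) :=
  M.filter (fun p => (p.2, p.1) ∈ M)

def FecX {V : Type*} [DecidableEq V] (G : SimpleGraph V) (M : Finset (V × V)) : Prop :=
  FecM G M ∧ ∀ M', FecM G M' → M'.card ≤ M.card ∧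
    (M'.card = M.card → (fecSy M').card ≤ (fecSy M).card)

theorem fec_exists {V : Type*} [Fintype V] [DecidableEq V] (G : SimpleGraph V)
    (M₀ : Finset (V × V)) (h0 : FecM G M₀) : ∃ M, FecX G M ∧ M₀.card ≤ M.card := by
  classical
  obtain ⟨M1, hM1, h1⟩ := Finset.exists_max_image (univ.filter (fun M => FecM G M))
    Finset.card ⟨M₀, by simpa using h0⟩
  simp only [mem_filter, mem_univ, true_and] at hM1 h1
  obtain ⟨M2, hM2, h2⟩ := Finset.exists_max_image
    (univ.filter (fun M => FecM G M ∧ M.card = M1.card))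
    (fun M => (fecSy M).card) ⟨M1, by simpa using hM1⟩
  simp only [mem_filter, mem_univ, true_and] at hM2 h2
  refine ⟨M2, ⟨hM2.1, fun M' h' => ⟨hM2.2 ▸ h1 M' h', fun hc => h2 M' ⟨h', hc.trans hM2.2⟩⟩⟩, ?_⟩
  rw [hM2.2]; exact h1 _ h0

theorem fec_E1 {V : Type*} [DecidableEq V] {G : SimpleGraph V} {M : Finset (V × V)}
    (h : FecX G M) {a b : V} (hab : (a, b) ∈ M) : ∃ c, (c, a) ∈ M := by
  by_contra hno
  push Not at hno
  obtain ⟨⟨hadj, ho, hi⟩, hmax⟩ := h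
  have hba : G.Adj b a := (hadj _ _ hab).symm
  by_cases hb : ∃ c, (b, c) ∈ M
  · obtain ⟨c, hc⟩ := hb
    have hM' : FecM G (insert (b, a) (M.erase (b, c))) := by
      refine ⟨?_, ?_, ?_⟩
      · intro p q; simp only [mem_insert, mem_erase, Prod.mk.injEq]; grind
      · intro p q r; simp only [mem_insert, mem_erase, Prod.mk.injEq]; grind
      · intro p q r; simp only [mem_insert, mem_erase, Prod.mk.injEq]; grind
    have hcard : (insert (b, a) (M.erase (b, c))).card = M.card := by
      rw [card_insert_of_notMem (by simp [hno]), card_erase_of_mem hc]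
      have := card_pos.2 ⟨_, hc⟩
      omega
    have := (hmax _ hM').2 hcard
    have hlt : (fecSy M) ⊂ fecSy (insert (b, a) (M.erase (b, c))) := by
      rw [ssubset_iff]
      refine ⟨(a, b), ?_, ?_⟩
      · simp [fecSy, hno]
      · intro p
        obtain ⟨p, q⟩ := p
        have : a ≠ b := hba.ne'
        simp only [fecSy, mem_insert, mem_filter, mem_erase, Prod.mk.injEq, ne_eq]
        grind
    exact absurd (card_lt_card hlt) (by omega)
  · push Not at hb
    have hM' : FecM G (insert (b, a) M) := by
      refine ⟨?_, ?_, ?_⟩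
      · intro p q; simp only [mem_insert, Prod.mk.injEq]; grind
      · intro p q r; simp only [mem_insert, Prod.mk.injEq]; grind
      · intro p q r; simp only [mem_insert, Prod.mk.injEq]; grind
    have := (hmax _ hM').1
    rw [card_insert_of_notMem (hb a)] at this
    omega

theorem fec_E2 {V : Type*} [DecidableEq V] {G : SimpleGraph V} {M : Finset (V × V)}
    (h : FecX G M) {a b : V} (hab : (a, b) ∈ M) : ∃ c, (b, c) ∈ M := by
  have h1 : M.image Prod.fst ⊆ M.image Prod.snd := by
    intro a ha
    simp only [mem_image, Prod.exists, exists_and_right, exists_eq_right] at ha ⊢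
    obtain ⟨b, hb⟩ := ha
    exact fec_E1 h hb
  have hc1 : (M.image Prod.fst).card = M.card := card_image_of_injOn (by
    rintro ⟨a, b⟩ h1 ⟨c, d⟩ h2 heq
    simp only at heq
    subst heq
    rw [h.1.2.1 a b d h1 h2])
  have hc2 : (M.image Prod.snd).card = M.card := card_image_of_injOn (by
    rintro ⟨a, b⟩ h1 ⟨c, d⟩ h2 heq
    simp only at heq
    subst heq
    rw [h.1.2.2 a c b h1 h2])
  have h2 := eq_of_subset_of_card_le h1 (by omega)
  have : b ∈ M.image Prod.snd := mem_image_of_mem Prod.snd hab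
  rw [← h2] at this
  simpa using this

theorem fec_F2a {V : Type*} [DecidableEq V] {G : SimpleGraph V} {M : Finset (V × V)}
    (h : FecX G M) {u v : V} (huv : G.Adj u v) (hu : ∀ c, (u, c) ∉ M) : ∃ w, (w, v) ∈ M := by
  by_contra hno
  push Not at hno
  obtain ⟨⟨hadj, ho, hi⟩, hmax⟩ := h
  have hM' : FecM G (insert (u, v) M) := by
    refine ⟨?_, ?_, ?_⟩
    · intro p q; simp only [mem_insert, Prod.mk.injEq]; grind
    · intro p q r; simp only [mem_insert, Prod.mk.injEq]; grind
    · intro p q r; simp only [mem_insert, Prod.mk.injEq]; grind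
  have := (hmax _ hM').1
  rw [card_insert_of_notMem (hu v)] at this
  omega

theorem fec_F2b {V : Type*} [DecidableEq V] {G : SimpleGraph V} {M : Finset (V × V)}
    (h : FecX G M) {u v w : V} (huv : G.Adj u v) (hu : ∀ c, (u, c) ∉ M)
    (hwv : (w, v) ∈ M) : (v, w) ∈ M := by
  by_contra hno
  have hu' : ∀ c, (c, u) ∉ M := fun c hc => by
    obtain ⟨d, hd⟩ := fec_E2 h hc
    exact hu d hd
  obtain ⟨hM, hmax⟩ := h
  obtain ⟨hadj, ho, hi⟩ := hM
  have hne : u ≠ v := huv.ne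
  have hM' : FecM G (insert (u, v) (M.erase (w, v))) := by
    refine ⟨?_, ?_, ?_⟩
    · intro p q; simp only [mem_insert, mem_erase, Prod.mk.injEq]; grind
    · intro p q r; simp only [mem_insert, mem_erase, Prod.mk.injEq]; grind
    · intro p q r; simp only [mem_insert, mem_erase, Prod.mk.injEq]; grind
  have hcard : (insert (u, v) (M.erase (w, v))).card = M.card := by
    rw [card_insert_of_notMem (by simp [hu]), card_erase_of_mem hwv]
    have := card_pos.2 ⟨_, hwv⟩
    omega
  have hsub : (fecSy M) ⊆ fecSy (insert (u, v) (M.erase (w, v))) := by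
    intro p
    obtain ⟨p, q⟩ := p
    simp only [fecSy, mem_insert, mem_filter, mem_erase, Prod.mk.injEq, ne_eq]
    grind
  have hX : FecX G (insert (u, v) (M.erase (w, v))) := by
    refine ⟨hM', fun N hN => ?_⟩
    rw [hcard]
    refine ⟨(hmax N hN).1, fun hc => ((hmax N hN).2 hc).trans (card_le_card hsub)⟩
  obtain ⟨c, hc⟩ := fec_E1 hX (mem_insert_self _ _)
  simp only [mem_insert, mem_erase, Prod.mk.injEq] at hc
  grind

theorem fec_F3 {V : Type*} [DecidableEq V] {G : SimpleGraph V} {M : Finset (V × V)}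
    (h : FecX G M) {u u' v w : V} (huv : G.Adj u v) (huw : G.Adj u' w) (hu : ∀ c, (u, c) ∉ M)
    (hu2 : ∀ c, (u', c) ∉ M) (hwv : (v, w) ∈ M) : u = u' := by
  by_contra hne
  have hu' : ∀ c, (c, u) ∉ M := fun c hc => by
    obtain ⟨d, hd⟩ := fec_E2 h hc
    exact hu d hd
  obtain ⟨⟨hadj, ho, hi⟩, hmax⟩ := h
  have hvu := huv.symm
  have hM' : FecM G (insert (u', w) (insert (v, u) (M.erase (v, w)))) := by
    have : u ≠ w := by rintro rfl; exact hu' _ hwv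
    have : u' ≠ v := by rintro rfl; exact hu2 _ hwv
    refine ⟨?_, ?_, ?_⟩
    · intro p q; simp only [mem_insert, mem_erase, Prod.mk.injEq]; grind
    · intro p q r; simp only [mem_insert, mem_erase, Prod.mk.injEq]; grind
    · intro p q r; simp only [mem_insert, mem_erase, Prod.mk.injEq]; grind
  have := (hmax _ hM').1
  have : u' ≠ v := by rintro rfl; exact hu2 _ hwv
  rw [card_insert_of_notMem (by simp [hu2, this]), card_insert_of_notMem (by simp [hu']),
    card_erase_of_mem hwv] at *
  have := card_pos.2 ⟨_, hwv⟩
  omega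

theorem fec_hall {V : Type*} [Fintype V] [DecidableEq V] (G : SimpleGraph V)
    [DecidableRel G.Adj] : ∃ (A : Finset V) (M : Finset (V × V)), FecM G M ∧
      Fintype.card V + (A.biUnion (fun v => G.neighborFinset v)).card ≤ A.card + M.card := by
  classical
  obtain ⟨A, -, hA⟩ := Finset.exists_max_image (univ : Finset (Finset V))
    (fun A => (A.card : ℤ) - ((A.biUnion (fun v => G.neighborFinset v)).card : ℤ)) ⟨∅, by simp⟩
  have h0 := hA ∅ (by simp)
  simp only [mem_univ, true_imp_iff] at hA
  simp at h0
  obtain ⟨d, hd⟩ := Nat.exists_eq_add_of_le h0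
  have hH := (Finset.all_card_le_biUnion_card_iff_exists_injective
    (fun v => (G.neighborFinset v).disjSum (univ : Finset (Fin d)))).1 (by
      intro s
      rcases s.eq_empty_or_nonempty with rfl | hs
      · simp
      have : s.biUnion (fun v => (G.neighborFinset v).disjSum (univ : Finset (Fin d))) =
          (s.biUnion (fun v => G.neighborFinset v)).disjSum univ := by
        obtain ⟨v, hv⟩ := hs
        ext x
        rcases x with x | x
        · simp
        · simp; exact ⟨v, hv⟩
      rw [this, card_disjSum]
      have := hA s
      simp only [card_univ, Fintype.card_fin]
      omega)
  obtain ⟨f, hf, hft⟩ := hH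
  refine ⟨A, univ.filter (fun p => f p.1 = Sum.inl p.2), ⟨?_, ?_, ?_⟩, ?_⟩
  · intro a b hab
    have := hft a
    simp only [mem_filter, mem_univ, true_and] at hab
    rw [hab] at this
    simpa using this
  · intro a b c h1 h2
    simp only [mem_filter, mem_univ, true_and] at h1 h2
    rw [h1] at h2
    exact Sum.inl.inj h2
  · intro a b c h1 h2
    simp only [mem_filter, mem_univ, true_and] at h1 h2
    exact hf (h1.trans h2.symm)
  · have hsub : (univ : Finset V).image f ⊆
      ((univ.filter (fun p : V × V => f p.1 = Sum.inl p.2)).image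
        (fun p => (Sum.inl p.2 : V ⊕ Fin d))) ∪ (univ : Finset (Fin d)).image Sum.inr := by
      intro x hx
      simp only [mem_image, mem_univ, true_and] at hx
      obtain ⟨v, rfl⟩ := hx
      rcases h : f v with x | x
      · simp; exact ⟨v, h⟩
      · simp
    have h1 := card_le_card hsub
    rw [card_image_of_injective _ hf] at h1
    have h2 := h1.trans (card_union_le _ _)
    have h3 := card_image_le (s := (univ.filter (fun p : V × V => f p.1 = Sum.inl p.2)))
      (f := (fun p => (Sum.inl p.2 : V ⊕ Fin d)))
    have h4 := card_image_le (s := (univ : Finset (Fin d))) (f := (Sum.inr : Fin d → V ⊕ Fin d))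
    simp only [card_univ, Fintype.card_fin] at h2 h4
    omega

theorem fec_perm {V : Type*} [Fintype V] [DecidableEq V] (G : SimpleGraph V)
    [DecidableRel G.Adj] : ∃ (σ : Equiv.Perm V) (A : Finset V),
      (∀ v, σ v ≠ v → G.Adj v (σ v)) ∧
      Fintype.card V + (A.biUnion (fun v => G.neighborFinset v)).card ≤
        A.card + (univ.filter (fun v => σ v ≠ v)).card ∧
      (∀ v, σ (σ v) ≠ v → Equiv.Perm.SameCycle (σ ^ 2) v (σ v)) ∧
      (∀ u v, σ u = u → G.Adj u v → σ v ≠ v ∧ σ (σ v) = v) ∧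
      (∀ u u' v, σ u = u → σ u' = u' → G.Adj u v → G.Adj u' (σ v) → u = u') := by
  classical
  obtain ⟨A, M₀, hM₀, hA⟩ := fec_hall G
  obtain ⟨M, hM, hMc⟩ := fec_exists G M₀ hM₀
  let f : V → V := fun v => if h : ∃ w, (v, w) ∈ M then h.choose else v
  have hf1 : ∀ v w, (v, w) ∈ M → f v = w := by
    intro v w h
    have h' : ∃ w, (v, w) ∈ M := ⟨w, h⟩
    simp only [f, dif_pos h']
    exact hM.1.2.1 _ _ _ h'.choose_spec h
  have hf2 : ∀ v, (∀ w, (v, w) ∉ M) → f v = v := by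
    intro v h
    have h' : ¬ ∃ w, (v, w) ∈ M := by simpa using h
    simp only [f, dif_neg h']
  have hinj : Function.Injective f := by
    intro a b hab
    by_cases ha : ∃ w, (a, w) ∈ M
    · obtain ⟨w, hw⟩ := ha
      by_cases hb : ∃ w, (b, w) ∈ M
      · obtain ⟨w', hw'⟩ := hb
        rw [hf1 _ _ hw, hf1 _ _ hw'] at hab
        subst hab
        exact hM.1.2.2 _ _ _ hw hw'
      · push Not at hb
        rw [hf1 _ _ hw, hf2 _ hb] at hab
        subst hab
        obtain ⟨c, hc⟩ := fec_E2 hM hw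
        exact absurd hc (hb c)
    · push Not at ha
      by_cases hb : ∃ w, (b, w) ∈ M
      · obtain ⟨w', hw'⟩ := hb
        rw [hf2 _ ha, hf1 _ _ hw'] at hab
        subst hab
        obtain ⟨c, hc⟩ := fec_E2 hM hw'
        exact absurd hc (ha c)
      · push Not at hb
        rwa [hf2 _ ha, hf2 _ hb] at hab
  let σ : Equiv.Perm V := Equiv.ofBijective f (Finite.injective_iff_bijective.1 hinj)
  have hσ : ∀ a b, (a, b) ∈ M ↔ σ a ≠ a ∧ σ a = b := by
    intro a b
    change _ ↔ f a ≠ a ∧ f a = b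
    constructor
    · intro h
      have := (hM.1.1 _ _ h).ne
      rw [hf1 _ _ h]
      exact ⟨this.symm, rfl⟩
    · rintro ⟨h1, h2⟩
      by_cases ha : ∃ w, (a, w) ∈ M
      · obtain ⟨w, hw⟩ := ha
        rw [hf1 _ _ hw] at h2
        rwa [← h2]
      · push Not at ha
        exact absurd (hf2 _ ha) h1
  clear_value σ
  clear hinj hf1 hf2
  have hfix : ∀ u, σ u = u → ∀ c, (u, c) ∉ M := fun u hu c hc => ((hσ _ _).1 hc).1 hu
  have hgr : ∀ t : V → V, (univ.filter (fun p : V × V => σ p.1 ≠ p.1 ∧ t p.1 = p.2)).card =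
      (univ.filter (fun v => σ v ≠ v)).card := by
    intro t
    symm
    refine card_bij (fun v _ => (v, t v)) ?_ ?_ ?_
    · intro a ha; simpa using ha
    · intro a _ b _ h; exact (Prod.mk.inj h).1
    · rintro ⟨a, b⟩ h
      simp only [mem_filter, mem_univ, true_and] at h
      refine ⟨a, by simpa using h.1, by rw [h.2]⟩
  have hMeq : M = univ.filter (fun p : V × V => σ p.1 ≠ p.1 ∧ σ p.1 = p.2) := by
    ext ⟨a, b⟩
    simp [hσ]
  have hMcard : M.card = (univ.filter (fun v => σ v ≠ v)).card := by
    rw [hMeq]; exact hgr σ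
  refine ⟨σ, A, fun v hv => hM.1.1 _ _ ((hσ _ _).2 ⟨hv, rfl⟩), by omega, ?_, ?_, ?_⟩
  · intro v hv
    by_contra hno
    have hO1 : ∀ w, Equiv.Perm.SameCycle (σ ^ 2) v w → ¬ Equiv.Perm.SameCycle (σ ^ 2) v (σ w) := by
      intro w hw hw'
      apply hno
      have : Equiv.Perm.SameCycle (σ ^ 2) (σ v) (σ w) := by
        obtain ⟨i, hi⟩ := hw
        refine ⟨i, ?_⟩
        rw [← hi, ← Equiv.Perm.mul_apply, ← Equiv.Perm.mul_apply]
        congr 1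
        exact (((Commute.refl σ).pow_left 2).zpow_left i).eq
      exact hw'.trans this.symm
    have hO2 : ∀ w, Equiv.Perm.SameCycle (σ ^ 2) v (σ (σ w)) ↔ Equiv.Perm.SameCycle (σ ^ 2) v w := by
      intro w
      rw [← Equiv.Perm.sameCycle_apply_right (f := σ ^ 2) (y := w)]
      simp [pow_two]
    obtain ⟨O, hO⟩ : ∃ O : V → Prop, ∀ w, O w ↔ Equiv.Perm.SameCycle (σ ^ 2) v w := ⟨_, fun _ => Iff.rfl⟩
    have hOv : O v := (hO v).2 (Equiv.Perm.SameCycle.refl _ _)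
    simp only [← hO] at hO1 hO2 hno
    clear hO
    let t : V → V := fun w => if O w then σ w else if O (σ w) then σ.symm w else σ w
    have ht : ∀ w, t w = if O w then σ w else if O (σ w) then σ.symm w else σ w := fun _ => rfl
    clear_value t
    have hss : ∀ w, σ (σ.symm w) = w := fun w => by simp
    have hss' : ∀ w, σ.symm (σ w) = w := fun w => by simp
    have htO : ∀ w, σ w ≠ w → G.Adj w (t w) := by
      intro w hw
      have h1 : G.Adj w (σ w) := hM.1.1 _ _ ((hσ _ _).2 ⟨hw, rfl⟩)
      have h2 : G.Adj (σ.symm w) w := by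
        have : σ (σ.symm w) ≠ σ.symm w := by
          rw [hss]; intro h; apply hw; nth_rewrite 1 [h]; exact hss w
        have := hM.1.1 _ _ ((hσ _ _).2 ⟨this, rfl⟩)
        rwa [hss] at this
      rw [ht]
      split_ifs
      exacts [h1, h2.symm, h1]
    have htinj : ∀ a b, t a = t b → a = b := by
      intro a b hab
      have ha := hO2 (σ.symm a)
      have hb := hO2 (σ.symm b)
      have h1 := hO1 (σ.symm a)
      have h2 := hO1 (σ.symm b)
      have h3 := hO2 a
      have h4 := hO2 b
      have h5 := hss a
      have h6 := hss b
      have h7 := hss' a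
      have h8 := hss' b
      have h9 := hO1 a
      have h10 := hO1 b
      rw [ht, ht] at hab
      grind
    have hM' : FecM G (univ.filter (fun p : V × V => σ p.1 ≠ p.1 ∧ t p.1 = p.2)) := by
      refine ⟨?_, ?_, ?_⟩
      · intro a b h
        simp only [mem_filter, mem_univ, true_and] at h
        rw [← h.2]; exact htO a h.1
      · intro a b c h h'
        simp only [mem_filter, mem_univ, true_and] at h h'
        rw [← h.2, ← h'.2]
      · intro a b c h h'
        simp only [mem_filter, mem_univ, true_and] at h h'
        exact htinj _ _ (h.2.trans h'.2.symm)
    have hle := (hM.2 _ hM').2 (by rw [hgr, hMcard])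
    have hlt : (fecSy M) ⊂ fecSy (univ.filter (fun p : V × V => σ p.1 ≠ p.1 ∧ t p.1 = p.2)) := by
      rw [ssubset_iff]
      refine ⟨(v, σ v), ?_, ?_⟩
      · simp only [fecSy, mem_filter, hσ]
        grind
      · rintro ⟨a, b⟩
        simp only [fecSy, mem_insert, mem_filter, mem_univ, true_and, hσ, Prod.mk.injEq]
        have := hss' a
        have := hss' b
        have := hss' v
        have := ht a
        have := ht b
        have := hO1 v hOv
        have : σ v ≠ v := by intro h; apply hv; rw [h, h]
        have : σ (σ v) ≠ σ v := fun h => this (σ.injective h)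
        have := ht v
        have := ht (σ v)
        have := (hO2 v).2 hOv
        grind
    exact absurd (card_lt_card hlt) (by omega)
  · intro u v hu huv
    obtain ⟨w, hw⟩ := fec_F2a hM huv (hfix u hu)
    have h2 := fec_F2b hM huv (hfix u hu) hw
    rw [hσ] at hw h2
    exact ⟨h2.1, by rw [h2.2, hw.2]⟩
  · intro u u' v hu hu' huv huv'
    by_cases hv : σ v = v
    · obtain ⟨w, hw⟩ := fec_F2a hM huv (hfix u hu)
      obtain ⟨c, hc⟩ := fec_E2 hM hw
      exact absurd hc (hfix v hv c)
    · exact fec_F3 hM huv huv' (hfix u hu) (hfix u' hu') ((hσ _ _).2 ⟨hv, rfl⟩)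

theorem fec_lower {V : Type*} [Fintype V] [DecidableEq V] (G : SimpleGraph V)
    [DecidableRel G.Adj] (A : Finset V) (y : Sym2 V → ℝ) (hy : IsFracEdgeCover G y) :
    ((Fintype.card V : ℝ) + A.card - (A.biUnion (fun v => G.neighborFinset v)).card) / 2 ≤
      ∑ e ∈ G.edgeFinset, y e := by
  classical
  set N := A.biUnion (fun v => G.neighborFinset v) with hN
  let z : V → ℝ := fun v => ((if v ∈ A then 1 else 0) + (1 - if v ∈ N then 1 else 0)) / 2
  have hz : ∀ v, 0 ≤ z v := by
    intro v; simp only [z]; split_ifs <;> norm_num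
  have hz2 : ∀ a b, G.Adj a b → z a + z b ≤ 1 := by
    intro a b hab
    have h1 : a ∈ A → b ∈ N := fun h => by simp only [hN, mem_biUnion]; exact ⟨a, h, by simpa using hab⟩
    have h2 : b ∈ A → a ∈ N := fun h => by simp only [hN, mem_biUnion]; exact ⟨b, h, by simpa using hab.symm⟩
    simp only [z]
    split_ifs <;> first | (norm_num; done) | (exfalso; tauto)
  have hsum : ((Fintype.card V : ℝ) + A.card - N.card) / 2 = ∑ v, z v := by
    simp only [z]
    rw [← Finset.sum_div, sum_add_distrib, sum_sub_distrib]
    simp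
    ring
  rw [hsum]
  calc ∑ v, z v ≤ ∑ v, z v * ∑ e ∈ G.incidenceFinset v, y e :=
        sum_le_sum fun v _ => le_mul_of_one_le_right (hz v) (hy.2.2 v)
    _ = ∑ v, ∑ e ∈ G.edgeFinset, if v ∈ e then z v * y e else 0 := by
        refine sum_congr rfl fun v _ => ?_
        rw [SimpleGraph.incidenceFinset_eq_filter, sum_filter, mul_sum]
        refine sum_congr rfl fun e _ => ?_
        split_ifs <;> simp
    _ = ∑ e ∈ G.edgeFinset, ∑ v, if v ∈ e then z v * y e else 0 := sum_comm
    _ ≤ ∑ e ∈ G.edgeFinset, y e := by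
        refine sum_le_sum fun e he => ?_
        induction e using Sym2.ind with
        | _ a b =>
          have hab : G.Adj a b := by simpa using he
          have : (univ.filter (fun v => v ∈ s(a, b))) = {a, b} := by ext; simp
          rw [← sum_filter, this, sum_pair hab.ne, ← add_mul]
          exact mul_le_of_le_one_left (hy.1 _).1 (hz2 a b hab)

theorem fec_cycle {V : Type*} [Fintype V] [DecidableEq V] (G : SimpleGraph V)
    (σ : Equiv.Perm V) (hadj : ∀ v, σ v ≠ v → G.Adj v (σ v)) (v : V) (hv : σ (σ v) ≠ v)
    (hodd : Equiv.Perm.SameCycle (σ ^ 2) v (σ v)) (S : Finset (Sym2 V))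
    (hS : ∀ e, e ∈ S ↔ ∃ w, Equiv.Perm.SameCycle σ v w ∧ s(w, σ w) = e) :
    IsOddCycleEdgeSet G S := by
  have hv1 : σ v ≠ v := by intro h; apply hv; rw [h, h]
  have hne : ∀ i : ℕ, σ ((σ ^ i) v) ≠ (σ ^ i) v := by
    intro i h
    rw [← Equiv.Perm.mul_apply, ← pow_succ', pow_succ, Equiv.Perm.mul_apply] at h
    exact hv1 ((σ ^ i).injective h)
  have hwalk : ∀ n : ℕ, ∃ p : G.Walk v ((σ ^ n) v), p.length = n ∧
      (∀ w, w ∈ p.support ↔ ∃ i ≤ n, (σ ^ i) v = w) ∧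
      (∀ e, e ∈ p.edges ↔ ∃ i < n, s((σ ^ i) v, (σ ^ (i + 1)) v) = e) ∧
      ((∀ i, 0 < i → i ≤ n → (σ ^ i) v ≠ v) → p.IsPath) := by
    intro n
    induction n with
    | zero =>
      refine ⟨SimpleGraph.Walk.nil, rfl, ?_, ?_, ?_⟩
      · intro w
        change w ∈ [v] ↔ _
        simp [eq_comm]
      · intro e
        change e ∈ [] ↔ _
        simp
      · intro _
        exact SimpleGraph.Walk.IsPath.nil
    | succ n ih =>
      obtain ⟨p, h1, h2, h3, h4⟩ := ih
      have ha : G.Adj ((σ ^ n) v) ((σ ^ (n + 1)) v) := by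
        rw [pow_succ', Equiv.Perm.mul_apply]
        exact hadj _ (hne n)
      refine ⟨p.concat ha, by simp [h1], ?_, ?_, ?_⟩
      · intro w
        rw [SimpleGraph.Walk.support_concat, List.mem_append, h2]
        simp only [List.mem_singleton]
        constructor
        · rintro (⟨i, hi, rfl⟩ | rfl)
          · exact ⟨i, by omega, rfl⟩
          · exact ⟨n + 1, le_rfl, rfl⟩
        · rintro ⟨i, hi, rfl⟩
          rcases Nat.lt_or_ge n i with h | h
          · right; rw [show i = n + 1 by omega]
          · left; exact ⟨i, h, rfl⟩
      · intro e
        rw [SimpleGraph.Walk.edges_concat, List.concat_eq_append, List.mem_append, h3]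
        simp only [List.mem_singleton]
        constructor
        · rintro (⟨i, hi, rfl⟩ | rfl)
          · exact ⟨i, by omega, rfl⟩
          · exact ⟨n, by omega, rfl⟩
        · rintro ⟨i, hi, rfl⟩
          rcases Nat.lt_or_ge i n with h | h
          · left; exact ⟨i, h, rfl⟩
          · right; rw [show i = n by omega]
      · intro h
        refine (h4 fun i h0 hi => h i h0 (by omega)).concat ?_ ha
        rw [h2]
        rintro ⟨i, hi, h'⟩
        rw [show n + 1 = i + (n + 1 - i) by omega, pow_add, Equiv.Perm.mul_apply] at h'
        exact h (n + 1 - i) (by omega) (by omega) ((σ ^ i).injective h').symm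
  set k := Function.minimalPeriod σ v with hk
  have hper : ∀ n : ℕ, (σ ^ n) v = v ↔ k ∣ n := by
    intro n
    rw [hk, ← Function.isPeriodicPt_iff_minimalPeriod_dvd, Function.IsPeriodicPt,
      Function.IsFixedPt, Equiv.Perm.iterate_eq_pow]
  have hkodd : Odd k := by
    obtain ⟨n, hn⟩ := hodd.exists_nat_pow_eq
    rw [← pow_mul] at hn
    have hn0 : n ≠ 0 := by
      rintro rfl
      exact hv1 (by simpa using hn.symm)
    rw [show 2 * n = 1 + (2 * n - 1) by omega, pow_add, pow_one, Equiv.Perm.mul_apply] at hn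
    have := (hper _).1 (σ.injective hn)
    exact Odd.of_dvd_nat ⟨n - 1, by omega⟩ this
  have hkpos : 0 < k := hkodd.pos
  have hk1 : k ≠ 1 := by
    intro h
    have := (hper 1).2 (by rw [h])
    exact hv1 (by simpa using this)
  obtain ⟨p, h1, h2, h3, h4⟩ := hwalk (k - 1)
  have hend : σ ((σ ^ (k - 1)) v) = v := by
    rw [← Equiv.Perm.mul_apply, ← pow_succ', Nat.sub_add_cancel hkpos]
    exact (hper k).2 dvd_rfl
  have ha : G.Adj ((σ ^ (k - 1)) v) v := by
    have := hadj _ (hne (k - 1))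
    rwa [hend] at this
  refine ⟨_, SimpleGraph.Walk.cons ha p, ?_, ?_, ?_⟩
  · rw [SimpleGraph.Walk.cons_isCycle_iff]
    refine ⟨h4 fun i h0 hi h => ?_, ?_⟩
    · have := Nat.le_of_dvd h0 ((hper i).1 h)
      omega
    · rw [h3]
      rintro ⟨i, hi, h⟩
      rw [Sym2.eq_iff] at h
      rcases h with ⟨h, -⟩ | ⟨h, h'⟩
      · rw [show k - 1 = i + (k - 1 - i) by omega, pow_add, Equiv.Perm.mul_apply] at h
        have := Nat.le_of_dvd (by omega) ((hper _).1 ((σ ^ i).injective h).symm)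
        omega
      · rw [pow_succ', Equiv.Perm.mul_apply, h] at h'
        rw [← h'] at hend
        exact hv hend
  · rw [SimpleGraph.Walk.length_cons, h1, Nat.sub_add_cancel hkpos]; exact hkodd
  · ext e
    rw [hS]
    simp only [SimpleGraph.Walk.edges_cons, List.toFinset_cons, mem_insert, List.mem_toFinset, h3]
    constructor
    · rintro ⟨w, hw, rfl⟩
      obtain ⟨n, rfl⟩ := hw.exists_nat_pow_eq
      have hmod : (σ ^ n) v = (σ ^ (n % k)) v := by
        conv_lhs => rw [← Nat.mod_add_div n k, pow_add, Equiv.Perm.mul_apply,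
          (hper (k * (n / k))).2 (dvd_mul_right _ _)]
      rw [hmod]
      have hlt := Nat.mod_lt n hkpos
      generalize n % k = j at hlt
      rcases Nat.lt_or_ge j (k - 1) with h | h
      · right
        exact ⟨j, h, by rw [pow_succ', Equiv.Perm.mul_apply]⟩
      · left
        rw [show j = k - 1 by omega, hend]
    · rintro (rfl | ⟨i, hi, rfl⟩)
      · exact ⟨_, ⟨((k - 1 : ℕ) : ℤ), by rw [zpow_natCast]⟩, by rw [hend]⟩
      · exact ⟨_, ⟨(i : ℤ), by rw [zpow_natCast]⟩, by rw [pow_succ', Equiv.Perm.mul_apply]⟩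
/-- Any finite graph `H` without isolated vertices admits an optimal fractional edge cover
whose support is a vertex-disjoint union of odd cycles (with weight `1/2` on their edges)
and stars (with weight `1` on their edges). -/
theorem stmt_5 {V : Type*} [Fintype V] [DecidableEq V] (H : SimpleGraph V)
    [DecidableRel H.Adj] (hiso : ∀ v : V, 0 < H.degree v) :
    ∃ x : Sym2 V → ℝ, IsFracEdgeCover H x ∧
      (∀ y : Sym2 V → ℝ, IsFracEdgeCover H y →
        ∑ e ∈ H.edgeFinset, x e ≤ ∑ e ∈ H.edgeFinset, y e) ∧
      ∃ P : Finset (Finset (Sym2 V)),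
        (∀ e : Sym2 V, x e ≠ 0 ↔ ∃ S ∈ P, e ∈ S) ∧
        (∀ S ∈ P, ∀ T ∈ P, S ≠ T →
          ∀ v : V, (∃ e ∈ S, v ∈ e) → ¬ (∃ e ∈ T, v ∈ e)) ∧
        (∀ S ∈ P,
          (IsOddCycleEdgeSet H S ∧ ∀ e ∈ S, x e = 1/2) ∨
          (IsStarEdgeSet H S ∧ ∀ e ∈ S, x e = 1)) := by
  classical
  obtain ⟨σ, A, hadj, hcard, F1, F2, F3⟩ := fec_perm H
  have hnb : ∀ v, ∃ w, H.Adj v w := by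
    intro v
    obtain ⟨w, hw⟩ := card_pos.1 (hiso v)
    exact ⟨w, by simpa using hw⟩
  choose a ha using hnb
  obtain ⟨g, hg⟩ : ∃ g : V → V, ∀ v, g v = if σ v = v then a v else σ v := ⟨_, fun _ => rfl⟩
  obtain ⟨rt, hrt⟩ : ∃ rt : V → V, ∀ v, rt v = if σ v = v then a v else v := ⟨_, fun _ => rfl⟩
  obtain ⟨wt, hwt⟩ : ∃ wt : V → ℝ, ∀ v, wt v = if σ v = v then 1 else 1 / 2 := ⟨_, fun _ => rfl⟩
  have hgadj : ∀ v, H.Adj v (g v) := by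
    intro v
    rw [hg]
    split_ifs with h
    exacts [ha v, hadj v h]
  have hwpos : ∀ v, 0 < wt v := by
    intro v; rw [hwt]; split_ifs <;> norm_num
  have hrtn : ∀ v, σ (rt v) ≠ rt v := by
    intro v
    rw [hrt]
    split_ifs with h
    exacts [(F2 v _ h (ha v)).1, h]
  have hrtg : ∀ v, σ.SameCycle (rt v) (rt (g v)) := by
    intro v
    by_cases h : σ v = v
    · have := hrtn v
      rw [hrt v, if_pos h] at this ⊢
      rw [hg, if_pos h, hrt, if_neg this]
    · have h' : σ (σ v) ≠ σ v := fun h' => h (σ.injective h')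
      rw [hrt v, if_neg h, hg, if_neg h, hrt, if_neg h']
      exact (Equiv.Perm.SameCycle.refl σ v).apply_right
  obtain ⟨x, hx⟩ : ∃ x : Sym2 V → ℝ, ∀ e, x e = ∑ v, if s(v, g v) = e then wt v else 0 :=
    ⟨_, fun _ => rfl⟩
  have hx0 : ∀ e, 0 ≤ x e := by
    intro e; rw [hx]
    exact sum_nonneg fun v _ => by split_ifs; exacts [(hwpos v).le, le_rfl]
  have hxne : ∀ e, x e ≠ 0 ↔ ∃ v, s(v, g v) = e := by
    intro e
    rw [hx, Ne, sum_eq_zero_iff_of_nonneg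
      (fun v _ => by split_ifs; exacts [(hwpos v).le, le_rfl])]
    constructor
    · intro h
      by_contra hno
      push Not at hno
      exact h fun v _ => if_neg (hno v)
    · rintro ⟨v, hv⟩ h
      have := h v (mem_univ v)
      rw [if_pos hv] at this
      exact (hwpos v).ne' this
  obtain ⟨S, hS⟩ : ∃ S : V → Finset (Sym2 V), ∀ v e, e ∈ S v ↔
      ∃ w, σ.SameCycle v (rt w) ∧ s(w, g w) = e :=
    ⟨fun v => (univ.filter (fun w => σ.SameCycle v (rt w))).image (fun w => s(w, g w)), by simp⟩
  have hStouch : ∀ v t, (∃ e ∈ S v, t ∈ e) → σ.SameCycle v (rt t) := by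
    rintro v t ⟨e, he, hte⟩
    obtain ⟨w, hw, rfl⟩ := (hS _ _).1 he
    rcases Sym2.mem_iff.1 hte with rfl | rfl
    · exact hw
    · exact hw.trans (hrtg w)
  have hSeq : ∀ v v', σ.SameCycle v v' → S v = S v' := by
    intro v v' h
    ext e
    rw [hS, hS]
    exact ⟨fun ⟨w, h1, h2⟩ => ⟨w, h.symm.trans h1, h2⟩, fun ⟨w, h1, h2⟩ => ⟨w, h.trans h1, h2⟩⟩
  have hval1 : ∀ u, σ u = u → x s(u, g u) = 1 := by
    intro u hu
    rw [hx, sum_eq_single u]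
    · rw [if_pos rfl, hwt, if_pos hu]
    · intro w _ hwu
      refine if_neg fun h => ?_
      rw [Sym2.eq_iff] at h
      rcases h with ⟨h, -⟩ | ⟨h1, h2⟩
      · exact hwu h
      · have h3 : σ w ≠ w := by
          have := (F2 u _ hu (hgadj u)).1
          rwa [← h1] at this
        rw [hg, if_neg h3] at h2
        rw [← h2] at hu
        exact h3 (σ.injective hu)
    · simp
  have hval2 : ∀ v, σ v ≠ v → σ (σ v) = v → x s(v, g v) = 1 := by
    intro v hv hvv
    have hv' : σ (σ v) ≠ σ v := fun h => hv (σ.injective h)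
    have hgv : g v = σ v := by rw [hg, if_neg hv]
    have hgv' : g (σ v) = v := by rw [hg, if_neg hv', hvv]
    rw [hx, ← sum_filter]
    have : univ.filter (fun w => s(w, g w) = s(v, g v)) = {v, σ v} := by
      ext w
      simp only [mem_filter, mem_univ, true_and, mem_insert, mem_singleton, Sym2.eq_iff]
      constructor
      · rintro (⟨h, -⟩ | ⟨h, -⟩)
        · exact Or.inl h
        · exact Or.inr (h.trans hgv)
      · rintro (rfl | rfl)
        · exact Or.inl ⟨rfl, rfl⟩
        · exact Or.inr ⟨hgv.symm, hgv'⟩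
    rw [this, sum_pair hv.symm, hwt, hwt, if_neg hv, if_neg hv']
    norm_num
  have hval3 : ∀ v, σ (σ v) ≠ v → x s(v, σ v) = 1 / 2 := by
    intro v hv
    have hv1 : σ v ≠ v := by intro h; apply hv; rw [h, h]
    have hgv : g v = σ v := by rw [hg, if_neg hv1]
    have hv' : σ (σ v) ≠ σ v := fun h => hv1 (σ.injective h)
    rw [← hgv, hx, sum_eq_single v]
    · rw [if_pos rfl, hwt, if_neg hv1]
    · intro w _ hwu
      refine if_neg fun h => ?_
      rw [Sym2.eq_iff] at h
      rcases h with ⟨h, -⟩ | ⟨h1, h2⟩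
      · exact hwu h
      · rw [hgv] at h1
        subst h1
        rw [hg, if_neg hv'] at h2
        exact hv h2
    · simp
  have hstruct : ∀ v, σ v ≠ v →
      (IsOddCycleEdgeSet H (S v) ∧ ∀ e ∈ S v, x e = 1/2) ∨
          (IsStarEdgeSet H (S v) ∧ ∀ e ∈ S v, x e = 1) := by
    intro v hv
    by_cases hvv : σ (σ v) = v
    · right
      have hcyc : ∀ w, σ.SameCycle v w → w = v ∨ w = σ v := by
        intro w hw
        obtain ⟨n, rfl⟩ := hw.exists_nat_pow_eq
        clear hw
        induction n with
        | zero => left; rfl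
        | succ n ih =>
          rw [pow_succ', Equiv.Perm.mul_apply]
          rcases ih with h | h
          · right; rw [h]
          · left; rw [h, hvv]
      have hv' : σ (σ v) ≠ σ v := fun h => hv (σ.injective h)
      refine ⟨⟨?_, ?_, ?_⟩, ?_⟩
      · exact ⟨s(v, g v), (hS _ _).2 ⟨v, by rw [hrt, if_neg hv], rfl⟩⟩
      · intro e he
        obtain ⟨w, -, rfl⟩ := (hS _ _).1 he
        simpa using hgadj w
      · by_cases hu : ∃ u, σ u = u ∧ g u = σ v
        · obtain ⟨u, hu, hgu⟩ := hu
          refine ⟨σ v, fun e he => ?_⟩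
          obtain ⟨w, hw, rfl⟩ := (hS _ _).1 he
          rw [Sym2.mem_iff]
          by_cases hwf : σ w = w
          · rw [hrt, if_pos hwf] at hw
            have hgw : g w = a w := by rw [hg, if_pos hwf]
            rw [← hgw] at hw
            rcases hcyc _ hw with h | h
            · exfalso
              have h1 := F3 w u v hwf hu (h ▸ hgadj w) (hgu ▸ hgadj u)
              subst h1
              exact hv (hgu.symm.trans h)
            · exact Or.inr h.symm
          · rw [hrt, if_neg hwf] at hw
            rcases hcyc _ hw with h | h
            · right; rw [hg, if_neg hwf, h]
            · exact Or.inl h.symm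
        · push Not at hu
          refine ⟨v, fun e he => ?_⟩
          obtain ⟨w, hw, rfl⟩ := (hS _ _).1 he
          rw [Sym2.mem_iff]
          by_cases hwf : σ w = w
          · rw [hrt, if_pos hwf] at hw
            have hgw : g w = a w := by rw [hg, if_pos hwf]
            rw [← hgw] at hw
            rcases hcyc _ hw with h | h
            · exact Or.inr h.symm
            · exact absurd h (hu w hwf)
          · rw [hrt, if_neg hwf] at hw
            rcases hcyc _ hw with h | h
            · exact Or.inl h.symm
            · right; rw [hg, if_neg hwf, h, hvv]
      · intro e he
        obtain ⟨w, hw, rfl⟩ := (hS _ _).1 he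
        by_cases hwf : σ w = w
        · exact hval1 w hwf
        · rw [hrt, if_neg hwf] at hw
          refine hval2 w hwf ?_
          rcases hcyc _ hw with rfl | rfl
          · exact hvv
          · rw [hvv]
    · left
      have hcyc : ∀ w, σ.SameCycle v w → σ (σ w) ≠ w := by
        intro w hw h
        obtain ⟨n, rfl⟩ := hw.exists_nat_pow_eq
        rw [← Equiv.Perm.mul_apply σ (σ ^ n), ← pow_succ', ← Equiv.Perm.mul_apply σ, ← pow_succ',
          pow_succ, pow_succ, Equiv.Perm.mul_apply, Equiv.Perm.mul_apply] at h
        exact hvv ((σ ^ n).injective h)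
      have hnf : ∀ w, σ.SameCycle v (rt w) → σ w ≠ w := by
        intro w hw hwf
        rw [hrt, if_pos hwf] at hw
        exact hcyc _ hw (F2 w _ hwf (ha w)).2
      have hS' : ∀ e, e ∈ S v ↔ ∃ w, σ.SameCycle v w ∧ s(w, σ w) = e := by
        intro e
        rw [hS]
        constructor
        · rintro ⟨w, hw, rfl⟩
          have h := hnf w hw
          rw [hrt, if_neg h] at hw
          exact ⟨w, hw, by rw [hg, if_neg h]⟩
        · rintro ⟨w, hw, rfl⟩
          have h : σ w ≠ w := fun h => hcyc w hw (by rw [h, h])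
          exact ⟨w, by rwa [hrt, if_neg h], by rw [hg, if_neg h]⟩
      refine ⟨fec_cycle H σ hadj v hvv (F1 v hvv) _ hS', ?_⟩
      intro e he
      obtain ⟨w, hw, rfl⟩ := (hS' _).1 he
      exact hval3 w (hcyc w hw)
  have hmemS : ∀ v, s(v, g v) ∈ S (rt v) := fun v =>
    (hS _ _).2 ⟨v, Equiv.Perm.SameCycle.refl _ _, rfl⟩
  have hedge : ∀ e, e ∉ H.edgeFinset → x e = 0 := by
    intro e he
    by_contra h
    obtain ⟨v, rfl⟩ := (hxne e).1 h
    exact he (by simpa using hgadj v)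
  have hcov : IsFracEdgeCover H x := by
    refine ⟨fun e => ⟨hx0 e, ?_⟩, hedge, ?_⟩
    · by_cases h : x e = 0
      · rw [h]; norm_num
      · obtain ⟨v, rfl⟩ := (hxne e).1 h
        rcases hstruct (rt v) (hrtn v) with ⟨-, h⟩ | ⟨-, h⟩
        · rw [h _ (hmemS v)]; norm_num
        · rw [h _ (hmemS v)]
    · intro t
      have h1 : ∑ e ∈ H.incidenceFinset t, x e =
          ∑ v, if t ∈ s(v, g v) then wt v else 0 := by
        simp only [hx]
        rw [sum_comm]
        refine sum_congr rfl fun v _ => ?_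
        rw [sum_ite_eq]
        refine if_congr ?_ rfl rfl
        rw [SimpleGraph.incidenceFinset_eq_filter, mem_filter]
        simp [hgadj v]
      rw [h1]
      have hnn : ∀ v, 0 ≤ if t ∈ s(v, g v) then wt v else 0 := fun v => by
        split_ifs; exacts [(hwpos v).le, le_rfl]
      by_cases ht : σ t = t
      · have := single_le_sum (f := fun v => if t ∈ s(v, g v) then wt v else 0)
          (fun v _ => hnn v) (mem_univ t)
        simp only [Sym2.mem_mk_left, if_true] at this
        rw [hwt t, if_pos ht] at this
        exact this
      · have hs : σ (σ.symm t) ≠ σ.symm t := by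
          intro h
          have h2 := congrArg σ h
          rw [Equiv.apply_symm_apply] at h2
          exact ht h2
        have hne : t ≠ σ.symm t := by
          rw [Equiv.apply_symm_apply] at hs
          exact hs
        have := sum_le_sum_of_subset_of_nonneg
          (f := fun v => if t ∈ s(v, g v) then wt v else 0)
          (subset_univ {t, σ.symm t}) (fun v _ _ => hnn v)
        rw [sum_pair hne] at this
        have hgs : g (σ.symm t) = t := by rw [hg, if_neg hs, Equiv.apply_symm_apply]
        simp only [hgs, Sym2.mem_mk_left, Sym2.mem_mk_right, if_true] at this
        rw [hwt t, hwt (σ.symm t), if_neg ht, if_neg hs] at this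
        refine le_trans ?_ this
        norm_num
  refine ⟨x, hcov, ?_, univ.image (fun v => S (rt v)), ?_, ?_, ?_⟩
  · intro y hy
    refine le_trans ?_ (fec_lower H A y hy)
    have h1 : ∑ e ∈ H.edgeFinset, x e = ∑ v, wt v := by
      simp only [hx]
      rw [sum_comm]
      refine sum_congr rfl fun v _ => ?_
      rw [sum_ite_eq, if_pos (by simpa using hgadj v)]
    have h2 : ∑ v, wt v = (Fintype.card V : ℝ) -
        ((univ.filter (fun v => σ v ≠ v)).card : ℝ) / 2 := by
      have : ∀ v, wt v = 1 - (if σ v ≠ v then 1 else 0) / 2 := by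
        intro v
        rw [hwt]
        by_cases h : σ v = v
        · simp [h]
        · simp only [h, if_false, ne_eq, not_false_eq_true, if_true]
          norm_num
      simp only [this]
      rw [sum_sub_distrib, ← Finset.sum_div, sum_boole]
      simp
    rw [h1, h2]
    have h3 : ((Fintype.card V : ℝ) + (A.biUnion (fun v => H.neighborFinset v)).card) ≤
        A.card + (univ.filter (fun v => σ v ≠ v)).card := by exact_mod_cast hcard
    linarith
  · intro e
    rw [hxne]
    constructor
    · rintro ⟨v, rfl⟩
      exact ⟨_, mem_image_of_mem _ (mem_univ v), hmemS v⟩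
    · rintro ⟨T, hT, he⟩
      obtain ⟨t, -, rfl⟩ := mem_image.1 hT
      obtain ⟨w, -, rfl⟩ := (hS _ _).1 he
      exact ⟨w, rfl⟩
  · intro T hT T' hT' hne v h1 h2
    obtain ⟨t, -, rfl⟩ := mem_image.1 hT
    obtain ⟨t', -, rfl⟩ := mem_image.1 hT'
    exact hne (hSeq _ _ ((hStouch _ _ h1).trans (hStouch _ _ h2).symm))
  · intro T hT
    obtain ⟨t, -, rfl⟩ := mem_image.1 hT
    exact hstruct _ (hrtn t)
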